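/- Let A, B, C, D be complex matrices of compatible sizes with A, D square. Set S = A − C D^d B, S_A = A A^d S A A^d, Z = D − B A^d C, Z_D = D D^d Z D D^d, and s = ind(Z_D). If D^d B A A^d = D^d D B A^d, then S_A^d = A^d + A^d C Z_D^d D^d B A A^d − ∑_{i=0}^{s-1} (A^d)^{i+2} C D D^d Z_D^i Z_D^π D^d B A A^d. -/

import Mathlib

open Matrix Finset

attribute [local instance] Classical.propDecidable

noncomputable def drazin {n : Type*} [Fintype n] [DecidableEq n]
    (A : Matrix n n ℂ) : Matrix n n ℂ :=
  if h : ∃ X : Matrix n n ℂ,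
      A * X = X * A ∧ X * A * X = X ∧ ∃ k : ℕ, A ^ (k + 1) * X = A ^ k
  then h.choose else 0

noncomputable def ind {n : Type*} [Fintype n] [DecidableEq n]
    (A : Matrix n n ℂ) : ℕ :=
  sInf {k : ℕ | (A ^ k).rank = (A ^ (k + 1)).rank}

noncomputable def spi {n : Type*} [Fintype n] [DecidableEq n]
    (A : Matrix n n ℂ) : Matrix n n ℂ :=
  1 - A * drazin A

theorem drazin_exists {n : Type*} [Fintype n] [DecidableEq n] (A : Matrix n n ℂ) :
    ∃ X : Matrix n n ℂ,
      A * X = X * A ∧ X * A * X = X ∧ ∃ k : ℕ, A ^ (k + 1) * X = A ^ k := by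
  have hne : A.charpoly ≠ 0 := A.charpoly_monic.ne_zero
  obtain ⟨q, hq, hnd⟩ := Polynomial.exists_eq_pow_rootMultiplicity_mul_and_not_dvd A.charpoly hne 0
  set k := A.charpoly.rootMultiplicity 0
  simp only [map_zero, sub_zero] at hq hnd
  rw [Polynomial.X_dvd_iff] at hnd
  have h0 : A ^ k * Polynomial.aeval A q = 0 := by
    have := A.aeval_self_charpoly
    rw [hq] at this
    simpa using this
  set c := q.coeff 0 with hc
  let r : Polynomial ℂ := -(Polynomial.C c⁻¹) * q.divX
  have hr : Polynomial.X * r = 1 - Polynomial.C c⁻¹ * q := by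
    have h1 := Polynomial.divX_mul_X_add q
    have h2 : Polynomial.C c⁻¹ * Polynomial.C c = (1 : Polynomial ℂ) := by
      rw [← Polynomial.C_mul, inv_mul_cancel₀ hnd, Polynomial.C_1]
    simp only [r]
    rw [← hc] at h1
    linear_combination (-Polynomial.C c⁻¹) * h1 + h2
  set p := Polynomial.aeval A r with hp
  have hcomm : Commute A p := by
    have := Polynomial.aeval_X (R := ℂ) A
    rw [hp]; nth_rewrite 1 [← this]
    exact (Commute.all Polynomial.X r).map (Polynomial.aeval A)
  have h1 : A ^ k * (A * p) = A ^ k := by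
    have := congrArg (Polynomial.aeval A) hr
    simp only [map_mul, Polynomial.aeval_X, map_sub, map_one, Polynomial.aeval_C] at this
    rw [hp, this, mul_sub, mul_one, Algebra.left_comm, h0, mul_zero, sub_zero]
  have h2 : ∀ j, A ^ k * (A * p) ^ j = A ^ k := by
    intro j
    induction j with
    | zero => simp
    | succ j ih => rw [pow_succ, ← mul_assoc, ih, h1]
  have hX : Commute A (A ^ k * p ^ (k+1)) :=
    ((Commute.refl A).pow_right k).mul_right (hcomm.pow_right _)
  have h3 : A ^ (k+1) * p ^ (k+1) = (A * p) ^ (k+1) := (hcomm.mul_pow _).symm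
  have h4 : A ^ (k+1) * (A ^ k * p ^ (k+1)) = A ^ k := by
    rw [← mul_assoc, ← pow_add, add_comm, pow_add, mul_assoc, h3, h2]
  refine ⟨A ^ k * p ^ (k+1), hX, ?_, k, h4⟩
  rw [← hX.eq, ← mul_assoc, mul_assoc A, mul_assoc (A ^ k), ← (hcomm.pow_pow k (k+1)).eq,
    ← mul_assoc, ← pow_succ', h4]

theorem drazin_spec {n : Type*} [Fintype n] [DecidableEq n] (A : Matrix n n ℂ) :
    A * drazin A = drazin A * A ∧ drazin A * A * drazin A = drazin A ∧
      ∃ k : ℕ, A ^ (k + 1) * drazin A = A ^ k := by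
  have h := drazin_exists A
  unfold drazin
  rw [dif_pos h]
  exact h.choose_spec

theorem drazin_pow_ge {n : Type*} [Fintype n] [DecidableEq n] (A : Matrix n n ℂ) :
    ∃ k : ℕ, ∀ j, k ≤ j → A ^ (j + 1) * drazin A = A ^ j := by
  obtain ⟨_, _, k, hk⟩ := drazin_spec A
  refine ⟨k, fun j hj => ?_⟩
  obtain ⟨l, rfl⟩ := Nat.exists_eq_add_of_le' hj
  rw [add_assoc, pow_add, mul_assoc, hk, pow_add]

theorem drazin_pow_mul {n : Type*} [Fintype n] [DecidableEq n] (A : Matrix n n ℂ) (k : ℕ) :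
    drazin A ^ (k + 1) * A ^ k = drazin A ∧ drazin A ^ (k + 1) * A ^ (k+1) = drazin A * A ∧
    A ^ k * drazin A ^ (k + 1) = drazin A ∧ A ^ (k+1) * drazin A ^ (k + 1) = A * drazin A := by
  obtain ⟨h1, h2, -⟩ := drazin_spec A
  have hc : Commute A (drazin A) := h1
  have a : drazin A ^ (k + 1) * A ^ k = drazin A := by
    induction k with
    | zero => simp
    | succ k ih =>
      rw [pow_succ' _ (k+1), pow_succ A, mul_assoc, ← mul_assoc _ (A ^ k), ih, ← h1, ← mul_assoc, h2]
  have b := (hc.pow_pow k (k+1)).eq.trans a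
  refine ⟨a, ?_, b, ?_⟩
  · rw [pow_succ A, ← mul_assoc, a]
  · rw [pow_succ' A, mul_assoc, b]

theorem drazin_intertwine {n m : Type*} [Fintype n] [DecidableEq n] [Fintype m] [DecidableEq m]
    (Z : Matrix m m ℂ) (S : Matrix n n ℂ) (v : Matrix m n ℂ) (h : Z * v = v * S) :
    drazin Z * v = v * drazin S := by
  have hp : ∀ k : ℕ, Z ^ k * v = v * S ^ k := by
    intro k
    induction k with
    | zero => simp
    | succ k ih => rw [pow_succ, Matrix.mul_assoc, h, ← Matrix.mul_assoc, ih, pow_succ, Matrix.mul_assoc]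
  obtain ⟨k1, hk1⟩ := drazin_pow_ge Z
  obtain ⟨k2, hk2⟩ := drazin_pow_ge S
  have e1 := hk1 (max k1 k2) (le_max_left _ _)
  have e2 := hk2 (max k1 k2) (le_max_right _ _)
  generalize max k1 k2 = k at e1 e2
  obtain ⟨z1, z2, -, -⟩ := drazin_pow_mul Z k
  obtain ⟨-, -, s3, s4⟩ := drazin_pow_mul S k
  have cz : Z ^ (k+1) * drazin Z = drazin Z * Z ^ (k+1) :=
    (Commute.pow_left (drazin_spec Z).1 (k+1))
  have l : drazin Z * v = drazin Z * Z * v * drazin S := by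
    calc drazin Z * v = drazin Z ^ (k+1) * (Z ^ k * v) := by rw [← Matrix.mul_assoc, z1]
      _ = drazin Z ^ (k+1) * (v * S ^ (k+1) * drazin S) := by
        rw [hp, Matrix.mul_assoc v, e2]
      _ = drazin Z ^ (k+1) * Z ^ (k+1) * v * drazin S := by
        rw [← hp]; simp only [Matrix.mul_assoc]
      _ = _ := by rw [z2]
  have r : v * drazin S = drazin Z * v * (S * drazin S) := by
    calc v * drazin S = v * S ^ k * drazin S ^ (k+1) := by rw [Matrix.mul_assoc, s3]
      _ = drazin Z * Z ^ (k+1) * v * drazin S ^ (k+1) := by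
        rw [← hp, ← cz, e1]
      _ = drazin Z * v * (S ^ (k+1) * drazin S ^ (k+1)) := by
        rw [Matrix.mul_assoc (drazin Z), hp]; simp only [Matrix.mul_assoc]
      _ = _ := by rw [s4]
  rw [l, r, Matrix.mul_assoc (drazin Z), h]; simp only [Matrix.mul_assoc]

theorem pow_mul_spi_comm {n : Type*} [Fintype n] [DecidableEq n] (A : Matrix n n ℂ) :
    Commute A (spi A) := by
  unfold spi
  exact (Commute.one_right A).sub_right ((Commute.refl A).mul_right (drazin_spec A).1)

theorem pow_mul_spi {n : Type*} [Fintype n] [DecidableEq n] (A : Matrix n n ℂ) :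
    ∃ k : ℕ, A ^ k * spi A = 0 := by
  obtain ⟨_, _, k, hk⟩ := drazin_spec A
  refine ⟨k, ?_⟩
  rw [spi, mul_sub, mul_one, ← mul_assoc, ← pow_succ, hk, sub_self]

theorem ind_pow_mul_spi {n : Type*} [Fintype n] [DecidableEq n] (A : Matrix n n ℂ) :
    A ^ (ind A) * spi A = 0 := by
  have hmem : ind A ∈ {k : ℕ | (A ^ k).rank = (A ^ (k + 1)).rank} := by
    apply Nat.sInf_mem
    obtain ⟨_, _, k, hk⟩ := drazin_spec A
    refine ⟨k, le_antisymm ?_ ?_⟩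
    · conv_lhs => rw [← hk]
      exact rank_mul_le_left _ _
    · rw [pow_succ]; exact rank_mul_le_left _ _
  simp only [Set.mem_ofPred_eq] at hmem
  generalize ind A = s at hmem
  have hker : ∀ x : n → ℂ, (A ^ (s+1)) *ᵥ x = 0 → (A ^ s) *ᵥ x = 0 := by
    have hle : LinearMap.ker (A ^ s).mulVecLin ≤ LinearMap.ker (A ^ (s+1)).mulVecLin := by
      intro x hx
      simp only [LinearMap.mem_ker, mulVecLin_apply] at hx ⊢
      rw [pow_succ', ← mulVec_mulVec, hx, mulVec_zero]
    have h1 := LinearMap.finrank_range_add_finrank_ker (A ^ s).mulVecLin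
    have h2 := LinearMap.finrank_range_add_finrank_ker (A ^ (s+1)).mulVecLin
    unfold Matrix.rank at hmem
    have he := Submodule.eq_of_le_of_finrank_eq hle (by omega)
    intro x hx
    have : x ∈ LinearMap.ker (A ^ s).mulVecLin := by
      rw [he]; simpa using hx
    simpa using this
  have hM : ∀ M : Matrix n n ℂ, A ^ (s+1) * M = 0 → A ^ s * M = 0 := by
    intro M hM
    apply Matrix.ext_of_mulVec_single
    intro i
    rw [← mulVec_mulVec, zero_mulVec]
    apply hker
    rw [mulVec_mulVec, hM, zero_mulVec]
  have hj : ∀ j, A ^ (s + j) * spi A = 0 → A ^ s * spi A = 0 := by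
    intro j
    induction j with
    | zero => exact id
    | succ j ih =>
      intro h
      apply ih
      rw [pow_add, mul_assoc]
      apply hM
      rw [← mul_assoc, ← pow_add, ← h]
      congr 2; omega
  obtain ⟨k, hk⟩ := pow_mul_spi A
  apply hj k
  rw [pow_add, mul_assoc, hk, mul_zero]

theorem stmt15 {n m : ℕ} (A : Matrix (Fin n) (Fin n) ℂ) (D : Matrix (Fin m) (Fin m) ℂ)
    (C : Matrix (Fin n) (Fin m) ℂ) (B : Matrix (Fin m) (Fin n) ℂ)
    (S : Matrix (Fin n) (Fin n) ℂ) (hS : S = A - C * drazin D * B)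
    (SA : Matrix (Fin n) (Fin n) ℂ) (hSA : SA = A * drazin A * S * (A * drazin A))
    (Z : Matrix (Fin m) (Fin m) ℂ) (hZ : Z = D - B * drazin A * C)
    (ZD : Matrix (Fin m) (Fin m) ℂ) (hZD : ZD = D * drazin D * Z * (D * drazin D))
    (h : drazin D * B * (A * drazin A) = drazin D * D * B * drazin A) :
    drazin SA = drazin A + drazin A * C * drazin ZD * drazin D * B * (A * drazin A) -
      ∑ i ∈ range (ind ZD),
        (drazin A) ^ (i + 2) * C * (D * drazin D) * ZD ^ i * spi ZD *
          drazin D * B * (A * drazin A) := by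
  have intw : ∀ (Z' : Matrix (Fin m) (Fin m) ℂ) (S' : Matrix (Fin n) (Fin n) ℂ)
      (v : Matrix (Fin m) (Fin n) ℂ), Z' * v = v * S' → ∀ i : ℕ, Z' ^ i * v = v * S' ^ i := by
    intro Z' S' v h i
    induction i with
    | zero => simp
    | succ k ih => rw [pow_succ, Matrix.mul_assoc, h, ← Matrix.mul_assoc, ih, pow_succ, Matrix.mul_assoc]
  obtain ⟨hA1, hA2, -⟩ := drazin_spec A
  obtain ⟨hD1, hD2, -⟩ := drazin_spec D
  obtain ⟨hs1, hs2, -⟩ := drazin_spec SA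
  obtain ⟨ks, hks⟩ := pow_mul_spi SA
  have hcs := pow_mul_spi_comm SA
  have hind := ind_pow_mul_spi ZD
  have hdz := drazin_intertwine ZD SA
  have hspiS : spi SA = 1 - SA * drazin SA := rfl
  have hspiZ : spi ZD = 1 - ZD * drazin ZD := rfl
  set α := drazin A
  set δ := drazin D
  set P := A * α with hP
  set v := δ * B * P with hv
  clear_value v P α δ
  generalize ind ZD = s at *
  have hPP : P * P = P := by
    rw [hP, mul_assoc, ← mul_assoc α, hA2]
  have hαP : α * P = α := by rw [hP, ← mul_assoc, hA2]
  have hαA : α * A = P := hA1.symm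
  have hPα : P * α = α := by rw [← hαA, hA2]
  have hQδ : D * δ * δ = δ := by rw [hD1, hD2]
  have hvP : v * P = v := by rw [hv, Matrix.mul_assoc, hPP]
  have hQv : D * δ * v = v := by
    rw [hv, ← Matrix.mul_assoc, ← Matrix.mul_assoc, hQδ]
  have hAP : A * P = P * A := by rw [hP, mul_assoc, hαA, hP]
  -- formula for SA
  have hSA' : SA = A * P - P * C * v := by
    rw [hSA, hS, mul_sub, sub_mul, ← hAP, mul_assoc A, hPP, hv]
    simp only [Matrix.mul_assoc]
  have hPSA : P * SA = SA := by
    rw [hSA, ← mul_assoc, ← mul_assoc, hPP]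
  have hZv : ZD * v = v * SA := by
    have e1 : D * δ * B * α = v := by rw [h, hD1]
    have e2 : ZD * v = D * δ * D * v - v * C * v := by
      rw [hZD, hZ, Matrix.mul_assoc _ (D * δ), hQv, mul_sub, Matrix.sub_mul, ← e1]
      simp only [Matrix.mul_assoc]
    have e3 : D * δ * D * v = D * δ * B * P := by
      rw [hv, hD1, ← Matrix.mul_assoc, ← Matrix.mul_assoc, mul_assoc (δ * D), hD1,
        ← mul_assoc, hD2]
    have e4 : v * (A * P) = D * δ * B * P := by
      rw [← Matrix.mul_assoc, ← e1, Matrix.mul_assoc _ α, hαA, Matrix.mul_assoc, hPP]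
    rw [e2, e3, hSA', Matrix.mul_sub, e4, ← Matrix.mul_assoc, ← Matrix.mul_assoc, hvP]
  have hZd := hdz v hZv
  have hZi := intw ZD SA v hZv
  have hZs : spi ZD * v = v * spi SA := by
    rw [hspiZ, hspiS, Matrix.sub_mul, Matrix.mul_sub, Matrix.one_mul, Matrix.mul_one,
      Matrix.mul_assoc, hZd, ← Matrix.mul_assoc, hZv, Matrix.mul_assoc]
  have hCv : α * C * v = P - α * SA := by
    rw [hSA', mul_sub, ← mul_assoc, hαA, hPP, ← Matrix.mul_assoc, ← Matrix.mul_assoc, hαP]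
    abel
  have hPd : P * drazin SA = drazin SA := by
    rw [← hs2, ← hs1, ← mul_assoc, ← mul_assoc, hPSA]
  have hαp : ∀ j : ℕ, α ^ (j + 1) * P = α ^ (j + 1) := by
    intro j
    rw [pow_succ, mul_assoc, hαP]
  -- each summand
  have hterm : ∀ i : ℕ, α ^ (i + 2) * C * (D * δ) * ZD ^ i * spi ZD * δ * B * P =
      α ^ (i + 1) * SA ^ i * spi SA - α ^ (i + 1 + 1) * SA ^ (i + 1) * spi SA := by
    intro i
    have e : ZD ^ i * spi ZD * v = v * SA ^ i * spi SA := by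
      rw [Matrix.mul_assoc, hZs, ← Matrix.mul_assoc, hZi]
    calc _ = α ^ (i + 1) * (α * C) * (D * δ) * (ZD ^ i * spi ZD * v) := by
          rw [hv, pow_succ α (i+1)]; simp only [Matrix.mul_assoc]
      _ = α ^ (i + 1) * (α * C * (D * δ * v)) * SA ^ i * spi SA := by
          rw [e]; simp only [Matrix.mul_assoc]
      _ = _ := by
          rw [hQv, hCv, mul_sub, hαp, ← mul_assoc, ← pow_succ, sub_mul, sub_mul,
            pow_succ' SA]
          simp only [Matrix.mul_assoc]
  have hsum : ∑ i ∈ range s, α ^ (i + 2) * C * (D * δ) * ZD ^ i * spi ZD * δ * B * P =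
      α * spi SA - α ^ (s + 1) * SA ^ s * spi SA := by
    rw [Finset.sum_congr rfl (fun i _ => hterm i),
      Finset.sum_range_sub' (fun i => α ^ (i + 1) * SA ^ i * spi SA)]
    simp
  -- the remainder vanishes
  have hN : α * (SA ^ s * spi SA) = 0 := by
    set N := SA ^ s * spi SA with hNdef
    have hcN : Commute SA N := ((Commute.refl SA).pow_right s).mul_right hcs
    have hvN : v * N = 0 := by
      rw [hNdef, ← Matrix.mul_assoc, ← hZi, Matrix.mul_assoc, ← hZs, ← Matrix.mul_assoc, hind,
        Matrix.zero_mul]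
    have hPN : P * N = α * SA * N := by
      have : (P - α * SA) * N = 0 := by rw [← hCv, Matrix.mul_assoc, hvN, Matrix.mul_zero]
      rwa [sub_mul, sub_eq_zero] at this
    have hj : ∀ j : ℕ, α * N = α ^ (j + 1) * (SA ^ j * N) := by
      intro j
      induction j with
      | zero => simp
      | succ j ih =>
        rw [ih, (hcN.pow_left j).eq, ← hαp j, mul_assoc, ← mul_assoc P, hPN, mul_assoc _ N,
          ← (hcN.pow_left j).eq, pow_succ α (j+1), pow_succ' SA]
        simp only [mul_assoc]
    have hk0 : SA ^ ks * N = 0 := by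
      rw [hNdef, ← mul_assoc, ← pow_add, add_comm, pow_add, mul_assoc, hks, mul_zero]
    rw [hj ks, hk0, mul_zero]
  have hmid : α * C * drazin ZD * δ * B * P = drazin SA - α * SA * drazin SA := by
    calc _ = α * C * (drazin ZD * v) := by rw [hv]; simp only [Matrix.mul_assoc]
      _ = _ := by rw [hZd, ← Matrix.mul_assoc, hCv, sub_mul, hPd]
  rw [hsum, hmid, pow_succ α, mul_assoc (α ^ s * α), mul_assoc (α ^ s), hN, mul_zero, hspiS,
    mul_sub, mul_one]
  simp only [mul_assoc]
  abel
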